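/- arXiv:1601.05434 — 3 statements merged into one kernel-verified Lean document; each statement's English description precedes it below -/
import Mathlib

section
/- Let B₁,…,B_n and E₁,…,E_n be finitely-valued random variables on a common probability space. Suppose that for each i ∈ {1,…,n}, writing V_i for the tuple (E₁,…,E_{i−1}, B_{i+1},…,B_n), one has I(V_i;B_i) ≥ I(V_i;E_i). Then H(B₁…B_n) − H(E₁…E_n) ≤ Σ_{i=1}^n ( H(B_i) − H(E_i) ). (Classical core of the additivity of coherent information for informationally degradable channels: the telescoping bound.) -/
open MeasureTheory

/-- Shannon entropy (natural log) of a finitely-valued random variable. -/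
noncomputable def entH {Ω : Type} [MeasurableSpace Ω] (μ : Measure Ω)
    {S : Type} [Fintype S] (X : Ω → S) : ℝ :=
  ∑ s : S, Real.negMulLog (μ (X ⁻¹' {s})).toReal

/-- Mutual information I(X;Y) := H(X) + H(Y) − H(XY). -/
noncomputable def mutInf {Ω : Type} [MeasurableSpace Ω] (μ : Measure Ω)
    {S T : Type} [Fintype S] [Fintype T] (X : Ω → S) (Y : Ω → T) : ℝ :=
  entH μ X + entH μ Y - entH μ (fun ω => (X ω, Y ω))

/-- Conditional mutual information I(X;Y|Z) := H(XZ) + H(YZ) − H(XYZ) − H(Z). -/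
noncomputable def condMutInf {Ω : Type} [MeasurableSpace Ω] (μ : Measure Ω)
    {S T U : Type} [Fintype S] [Fintype T] [Fintype U]
    (X : Ω → S) (Y : Ω → T) (Z : Ω → U) : ℝ :=
  entH μ (fun ω => (X ω, Z ω)) + entH μ (fun ω => (Y ω, Z ω))
    - entH μ (fun ω => (X ω, Y ω, Z ω)) - entH μ Z

lemma entH_comp_inj {Ω : Type} [MeasurableSpace Ω] (μ : Measure Ω)
    {S T : Type} [Fintype S] [Fintype T] (X : Ω → S) (f : S → T) (hf : Function.Injective f) :
    entH μ (fun ω => f (X ω)) = entH μ X := by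
  unfold entH
  symm
  apply Finset.sum_of_injOn f hf.injOn
  · intro x _; simp
  · intro t _ ht
    have : (fun ω => f (X ω)) ⁻¹' {t} = ∅ := by
      ext ω
      simp only [Set.mem_preimage, Set.mem_singleton_iff, Set.mem_empty_iff_false, iff_false]
      intro h
      exact ht ⟨X ω, by simp, h⟩
    rw [this]; simp
  · intro s _
    congr 3
    ext ω
    simp [hf.eq_iff]

lemma entH_congr {Ω : Type} [MeasurableSpace Ω] (μ : Measure Ω)
    {S T : Type} [Fintype S] [Fintype T] (X : Ω → S) (Y : Ω → T)
    (h : ∀ a b, X a = X b ↔ Y a = Y b) : entH μ X = entH μ Y := by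
  classical
  haveI : Fintype (Set.range X) := Fintype.ofFinite _
  have h1 := entH_comp_inj μ (Set.rangeFactorization X) (fun x => x.1) Subtype.val_injective
  have hc : ∀ ω, Y (Set.rangeFactorization X ω).2.choose = Y ω := fun ω =>
    (h _ _).1 (Set.rangeFactorization X ω).2.choose_spec
  have h2 := entH_comp_inj μ (Set.rangeFactorization X) (fun x => Y x.2.choose) (by
    intro x y hxy
    have := (h _ _).2 hxy
    rw [x.2.choose_spec, y.2.choose_spec] at this
    exact Subtype.ext this)
  simp only [hc] at h2
  exact h1.trans h2.symm

/-- classical core of the additivity of coherent information for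
informationally degradable channels (telescoping bound).  For each `i`, the
side information `V i` is the tuple `(E 1, …, E (i-1), B (i+1), …, B n)`,
encoded as a dependent function assigning `none` at index `i`. -/
theorem informational_degradability_telescoping
    (n : ℕ) (Ω : Type) [MeasurableSpace Ω] (μ : Measure Ω) [IsProbabilityMeasure μ]
    (S T : Fin n → Type) [∀ i, Fintype (S i)] [∀ i, Fintype (T i)]
    [∀ i, MeasurableSpace (S i)] [∀ i, MeasurableSpace (T i)]
    (B : ∀ i, Ω → S i) (E : ∀ i, Ω → T i)
    (hB : ∀ i, Measurable (B i)) (hE : ∀ i, Measurable (E i))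
    (hdeg : ∀ i : Fin n,
      mutInf μ
        (fun ω (j : Fin n) =>
          if j < i then (some (Sum.inl (E j ω)) : Option (T j ⊕ S j))
          else if i < j then some (Sum.inr (B j ω)) else none)
        (B i)
      ≥ mutInf μ
        (fun ω (j : Fin n) =>
          if j < i then (some (Sum.inl (E j ω)) : Option (T j ⊕ S j))
          else if i < j then some (Sum.inr (B j ω)) else none)
        (E i)) :
    entH μ (fun ω => (fun j => B j ω)) - entH μ (fun ω => (fun j => E j ω))
      ≤ ∑ i : Fin n, (entH μ (B i) - entH μ (E i)) := by
  classical
  let W : ℕ → Ω → (∀ j : Fin n, T j ⊕ S j) := fun k ω j =>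
    if j.1 < k then Sum.inl (E j ω) else Sum.inr (B j ω)
  have hW0 : entH μ (W 0) = entH μ (fun ω => (fun j => B j ω)) := by
    apply entH_congr
    intro a b
    simp [W, funext_iff]
  have hWn : entH μ (W n) = entH μ (fun ω => (fun j => E j ω)) := by
    apply entH_congr
    intro a b
    simp [W, funext_iff]
  have key : ∀ i : Fin n, entH μ (W i.1) - entH μ (W (i.1 + 1)) ≤ entH μ (B i) - entH μ (E i) := by
    intro i
    have h := hdeg i
    unfold mutInf at h
    have e1 : entH μ (W i.1) = _ := entH_congr μ (W i.1) (fun ω => ((fun (j : Fin n) =>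
          if j < i then (some (Sum.inl (E j ω)) : Option (T j ⊕ S j))
          else if i < j then some (Sum.inr (B j ω)) else none), B i ω)) (by
      intro a b
      simp only [W, funext_iff, Prod.mk.injEq]
      constructor
      · intro h
        refine ⟨fun j => ?_, by simpa using h i⟩
        have := h j
        rcases lt_trichotomy j i with hj | hj | hj
        · simpa [hj] using this
        · simp [hj]
        · simpa [hj, hj.not_gt, hj.le] using this
      · rintro ⟨h, hi⟩ j
        have := h j
        rcases lt_trichotomy j i with hj | hj | hj
        · simpa [hj] using this
        · subst hj; simp [hi]
        · simpa [hj, hj.not_gt, hj.le] using this)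
    have e2 : entH μ (W (i.1 + 1)) = _ := entH_congr μ (W (i.1 + 1)) (fun ω => ((fun (j : Fin n) =>
          if j < i then (some (Sum.inl (E j ω)) : Option (T j ⊕ S j))
          else if i < j then some (Sum.inr (B j ω)) else none), E i ω)) (by
      intro a b
      simp only [W, funext_iff, Prod.mk.injEq, Nat.lt_succ_iff, Fin.val_fin_le]
      constructor
      · intro h
        refine ⟨fun j => ?_, by simpa using h i⟩
        have := h j
        rcases lt_trichotomy j i with hj | hj | hj
        · simpa [hj, hj.le] using this
        · simp [hj]
        · simpa [hj, hj.not_gt, hj.not_ge] using this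
      · rintro ⟨h, hi⟩ j
        have := h j
        rcases lt_trichotomy j i with hj | hj | hj
        · simpa [hj, hj.le] using this
        · subst hj; simp [hi]
        · simpa [hj, hj.not_gt, hj.not_ge] using this)
    rw [e1, e2]
    linarith
  rw [← hW0, ← hWn, ← Finset.sum_range_sub' (fun k => entH μ (W k)) n,
    ← Fin.sum_univ_eq_sum_range (fun k => entH μ (W k) - entH μ (W (k + 1))) n]
  exact Finset.sum_le_sum fun i _ => key i
end

section
/- The entropic expression Q := H(E₁B₂) + H(B₁E₂) − H(B₁B₂) − H(E₁E₂) takes both signs: there exist a probability space and {0,1}-valued random variables B₁, B₂, E₁, E₂ with Q = log 2 (namely B₁ = R₁, B₂ = R₂, E₁ = E₂ = R₁ ⊕ R₂ for independent uniform bits R₁, R₂), and there exist a probability space and {0,1}-valued random variables with Q = −log 2 (namely B₁ = E₂ = R₁ and E₁ = B₂ = 0 for a uniform bit R₁). (This forces α_EV = 0 in the characterization of uniform additivity under the (1,1) decoupling.) -/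
open MeasureTheory

open ProbabilityTheory

/-- Probabilities of fibres on a finite space whose points all have mass `c`. -/
theorem fibre_toReal {Ω : Type} [Fintype Ω] [MeasurableSpace Ω] [MeasurableSingletonClass Ω]
    (μ : Measure Ω) [IsProbabilityMeasure μ] (c : ℝ) (hc : ∀ ω, (μ {ω}).toReal = c)
    {S : Type} [DecidableEq S] (X : Ω → S) (s : S) :
    (μ (X ⁻¹' {s})).toReal = ∑ ω : Ω, if X ω = s then c else 0 := by
  classical
  have h : X ⁻¹' {s} = ((Finset.univ.filter fun ω => X ω = s : Finset Ω) : Set Ω) := by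
    ext ω; simp
  rw [h, ← sum_measure_singleton, ENNReal.toReal_sum (fun _ _ => measure_ne_top _ _),
    Finset.sum_filter]
  simp [hc]

theorem negMulLog_half : Real.negMulLog (1 / 2) = Real.log 2 / 2 := by
  simp [Real.negMulLog, Real.log_inv]; ring

theorem negMulLog_quarter : Real.negMulLog (1 / 4) = Real.log 2 / 2 := by
  have : Real.log 4 = 2 * Real.log 2 := by
    rw [show (4 : ℝ) = 2 ^ 2 by norm_num, Real.log_pow]; norm_num
  simp [Real.negMulLog, Real.log_inv, this]; ring

theorem unif_singleton (x : Fin 2) :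
    (uniformOn (Set.univ : Set (Fin 2))) {x} = 1 / 2 := by
  rw [uniformOn_univ]; simp

/-- the expression Q := H(E₁B₂) + H(B₁E₂) − H(B₁B₂) − H(E₁E₂)
takes both signs: Q = log 2 for B₁ = R₁, B₂ = R₂, E₁ = E₂ = R₁ ⊕ R₂ with R₁, R₂
independent uniform bits, and Q = −log 2 for B₁ = E₂ = R₁, E₁ = B₂ = 0 with R₁
a uniform bit.  Bits are modeled as `Fin 2`, whose addition is addition mod 2. -/
theorem Q_takes_both_signs :
    (∃ (Ω : Type) (_ : MeasurableSpace Ω) (μ : Measure Ω) (_ : IsProbabilityMeasure μ)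
      (R1 R2 : Ω → Fin 2),
      Measurable R1 ∧ Measurable R2 ∧
      IndepFun R1 R2 μ ∧
      (∀ x : Fin 2, μ (R1 ⁻¹' {x}) = 1/2) ∧
      (∀ x : Fin 2, μ (R2 ⁻¹' {x}) = 1/2) ∧
      (let B1 := R1; let B2 := R2
       let E1 := fun ω => R1 ω + R2 ω; let E2 := fun ω => R1 ω + R2 ω
       entH μ (fun ω => (E1 ω, B2 ω)) + entH μ (fun ω => (B1 ω, E2 ω))
         - entH μ (fun ω => (B1 ω, B2 ω)) - entH μ (fun ω => (E1 ω, E2 ω))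
         = Real.log 2))
    ∧
    (∃ (Ω : Type) (_ : MeasurableSpace Ω) (μ : Measure Ω) (_ : IsProbabilityMeasure μ)
      (R1 : Ω → Fin 2),
      Measurable R1 ∧
      (∀ x : Fin 2, μ (R1 ⁻¹' {x}) = 1/2) ∧
      (let B1 := R1; let E2 := R1
       let E1 : Ω → Fin 2 := fun _ => 0; let B2 : Ω → Fin 2 := fun _ => 0
       entH μ (fun ω => (E1 ω, B2 ω)) + entH μ (fun ω => (B1 ω, E2 ω))
         - entH μ (fun ω => (B1 ω, B2 ω)) - entH μ (fun ω => (E1 ω, E2 ω))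
         = -Real.log 2)) := by
  haveI hP : IsProbabilityMeasure (uniformOn (Set.univ : Set (Fin 2))) :=
    uniformOn_isProbabilityMeasure Set.finite_univ Set.univ_nonempty
  refine ⟨⟨Fin 2 × Fin 2, inferInstance,
    (uniformOn (Set.univ : Set (Fin 2))).prod (uniformOn (Set.univ : Set (Fin 2))),
    inferInstance, Prod.fst, Prod.snd, measurable_fst, measurable_snd, ?_, ?_, ?_, ?_⟩,
    ⟨Fin 2, inferInstance, uniformOn (Set.univ : Set (Fin 2)), hP, id, measurable_id, ?_, ?_⟩⟩
  · exact indepFun_prod (X := id) (Y := id) measurable_id measurable_id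
  · intro x
    rw [← Set.prod_univ, Measure.prod_prod, unif_singleton, measure_univ, mul_one]
  · intro x
    rw [← Set.univ_prod, Measure.prod_prod, unif_singleton, measure_univ, one_mul]
  · have hc : ∀ ω : Fin 2 × Fin 2, (((uniformOn (Set.univ : Set (Fin 2))).prod
        (uniformOn (Set.univ : Set (Fin 2)))) {ω}).toReal = 1 / 4 := by
      rintro ⟨a, b⟩
      rw [← Set.singleton_prod_singleton, Measure.prod_prod, unif_singleton, unif_singleton,
        ENNReal.toReal_mul]
      norm_num
    have e : (1 / 4 : ℝ) + 1 / 4 = 1 / 2 := by norm_num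
    simp only [entH, fibre_toReal _ _ hc, Fintype.sum_prod_type, Fin.sum_univ_two, Prod.mk.injEq]
    simp [-one_div, e, negMulLog_half, negMulLog_quarter]
    try ring
  · exact fun x => unif_singleton x
  · have hc : ∀ ω : Fin 2, ((uniformOn (Set.univ : Set (Fin 2))) {ω}).toReal = 1 / 2 := by
      intro a
      rw [unif_singleton]
      norm_num
    have e : (1 / 2 : ℝ) + 1 / 2 = 1 := by norm_num
    simp only [entH, fibre_toReal _ _ hc, Fintype.sum_prod_type, Fin.sum_univ_two, Prod.mk.injEq]
    simp [-one_div, e, negMulLog_half]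
    try ring
end

section
/- A triple of real numbers (α_B, α_E, α_BE) satisfies the four inequalities α_B + α_BE ≥ 0, α_E + α_BE ≥ 0, α_B + α_E + α_BE ≥ 0 and α_BE ≥ 0 if and only if there exist nonnegative reals λ₁, λ₂, λ₃, λ₄ such that α_B = λ₁ − λ₄, α_E = λ₂ − λ₃, and α_BE = λ₃ + λ₄. (Equivalence of the facet description and the extreme-ray description of the zero-auxiliary-variable uniform additivity cone; the extreme rays correspond to the formulas H(B), H(E), H(B|E) and H(E|B).) -/
/-- equivalence of the facet (H-) description and the extreme-ray
(V-) description of the zero-auxiliary-variable uniform additivity cone. -/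
theorem zero_aux_cone_H_eq_V (αB αE αBE : ℝ) :
    (αB + αBE ≥ 0 ∧ αE + αBE ≥ 0 ∧ αB + αE + αBE ≥ 0 ∧ αBE ≥ 0)
    ↔ ∃ lam1 lam2 lam3 lam4 : ℝ, 0 ≤ lam1 ∧ 0 ≤ lam2 ∧ 0 ≤ lam3 ∧ 0 ≤ lam4 ∧
        αB = lam1 - lam4 ∧ αE = lam2 - lam3 ∧ αBE = lam3 + lam4 := by
  constructor
  · rintro ⟨h1, h2, h3, h4⟩
    rcases le_total 0 αB with h | h
    · refine ⟨αB, αE + αBE, αBE, 0, ?_, ?_, ?_, ?_, ?_, ?_, ?_⟩ <;> linarith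
    · refine ⟨0, αE + αBE + αB, αBE + αB, -αB, ?_, ?_, ?_, ?_, ?_, ?_, ?_⟩ <;> linarith
  · rintro ⟨a, b, c, d, ha, hb, hc, hd, h1, h2, h3⟩
    refine ⟨?_, ?_, ?_, ?_⟩ <;> linarith
end
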